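/- If K1 ⊆ K2 are convex bodies (compact convex sets with nonempty interior) contained in an open hemisphere of the unit sphere S^2, then the perimeter of the boundary of K1 is at most the perimeter of the boundary of K2, with equality only if K1 = K2. -/

import Mathlib

open scoped RealInnerProductSpace MeasureTheory

noncomputable section

/-- The unit sphere `S²` in `ℝ³`. -/
local notation "S²" => Metric.sphere (0 : EuclideanSpace ℝ (Fin 3)) 1

/-- Geodesic convexity on the sphere: any point on a minimizing great-circle arc
between two points of `K` again lies in `K`. -/
def SphericallyConvex (K : Set S²) : Prop :=
  ∀ x ∈ K, ∀ y ∈ K, ∀ z : S²,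
    Real.arccos ⟪(x : EuclideanSpace ℝ (Fin 3)), (z : EuclideanSpace ℝ (Fin 3))⟫ +
      Real.arccos ⟪(z : EuclideanSpace ℝ (Fin 3)), (y : EuclideanSpace ℝ (Fin 3))⟫ =
      Real.arccos ⟪(x : EuclideanSpace ℝ (Fin 3)), (y : EuclideanSpace ℝ (Fin 3))⟫ →
    z ∈ K

theorem aux_chord_le {X : Type*} [MetricSpace X] [MeasurableSpace X] [BorelSpace X]
    (γ : ℝ → X) (hγ : Continuous γ) (a b : ℝ) (hab : a ≤ b) :
    edist (γ a) (γ b) ≤ μH[1] (γ '' Set.Icc a b) := by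
  have hL : LipschitzWith 1 (fun x : X => dist (γ a) x) := LipschitzWith.dist_right (γ a)
  have h1 := hL.hausdorffMeasure_image_le (d := 1) zero_le_one (γ '' Set.Icc a b)
  simp only [ENNReal.coe_one, ENNReal.one_rpow, one_mul] at h1
  refine le_trans ?_ h1
  have hsub : Set.Icc 0 (dist (γ a) (γ b)) ⊆
      (fun x : X => dist (γ a) x) '' (γ '' Set.Icc a b) := by
    rw [← Set.image_comp]
    have hc : ContinuousOn ((fun x : X => dist (γ a) x) ∘ γ) (Set.Icc a b) := by
      apply Continuous.continuousOn
      exact (continuous_const.dist continuous_id).comp hγ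
    have := intermediate_value_Icc hab hc
    simpa using this
  refine le_trans ?_ (MeasureTheory.measure_mono hsub)
  rw [MeasureTheory.hausdorffMeasure_real, Real.volume_Icc, sub_zero, edist_dist]

theorem aux_singleton {X : Type*} [MetricSpace X] [MeasurableSpace X] [BorelSpace X] (x : X) :
    μH[1] ({x} : Set X) = 0 := by
  have := MeasureTheory.Measure.nullSingletonClass_hausdorff X (d := 1) one_pos
  exact MeasureTheory.measure_singleton x

theorem aux_Icc_le_Ioo {X : Type*} [MetricSpace X] [MeasurableSpace X] [BorelSpace X]
    (γ : ℝ → X) (a b : ℝ) :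
    μH[1] (γ '' Set.Icc a b) ≤ μH[1] (γ '' Set.Ioo a b) := by
  have : γ '' Set.Icc a b ⊆ γ '' Set.Ioo a b ∪ ({γ a} ∪ {γ b}) := by
    rintro _ ⟨t, ht, rfl⟩
    rcases eq_or_lt_of_le ht.1 with h | h
    · right; left; simp [h]
    rcases eq_or_lt_of_le ht.2 with h' | h'
    · right; right; simp [h']
    · left; exact ⟨t, ⟨h, h'⟩, rfl⟩
  refine (MeasureTheory.measure_mono this).trans ((MeasureTheory.measure_union_le _ _).trans ?_)
  have h2 : μH[1] ({γ a} ∪ {γ b} : Set X) = 0 := by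
    refine le_antisymm ((MeasureTheory.measure_union_le _ _).trans ?_) bot_le
    simp [aux_singleton]
  rw [h2, add_zero]

theorem aux_image_le_variation {X : Type*} [MetricSpace X] [MeasurableSpace X] [BorelSpace X]
    (γ : ℝ → X) (a b : ℝ) (hab : a ≤ b) (hv : LocallyBoundedVariationOn γ (Set.Icc a b)) :
    μH[1] (γ '' Set.Icc a b) ≤ eVariationOn γ (Set.Icc a b) := by
  set s := Set.Icc a b with hs
  have ha : a ∈ s := ⟨le_rfl, hab⟩
  have hb : b ∈ s := ⟨hab, le_rfl⟩
  set φ := variationOnFromTo γ s a with hφ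
  set c := naturalParameterization γ s a with hc
  have hu : HasUnitSpeedOn c (φ '' s) := has_unit_speed_naturalParameterization γ hv ha
  have heq : ∀ t ∈ s, c (φ t) = γ t := fun t ht =>
    edist_eq_zero.1 (edist_naturalParameterization_eq_zero hv ha ht)
  have himg : γ '' s = c '' (φ '' s) := by
    rw [Set.image_image]
    exact (Set.image_congr heq).symm
  have key : ∀ x ∈ φ '' s, ∀ y ∈ φ '' s, x ≤ y → edist (c x) (c y) ≤ edist x y := by
    intro x hx y hy hxy
    have := hu hx hy
    refine (eVariationOn.edist_le c (s := φ '' s ∩ Set.Icc x y) ⟨hx, le_rfl, hxy⟩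
      ⟨hy, hxy, le_rfl⟩).trans ?_
    rw [this]
    simp only [NNReal.coe_one, one_mul]
    rw [edist_comm, edist_dist, Real.dist_eq, abs_of_nonneg (sub_nonneg.2 hxy)]
  have hlip : LipschitzOnWith 1 c (φ '' s) := by
    intro x hx y hy
    simp only [ENNReal.coe_one, one_mul]
    rcases le_total x y with h | h
    · exact key x hx y hy h
    · rw [edist_comm, edist_comm x y]; exact key y hy x hx h
  rw [himg]
  have h1 := hlip.hausdorffMeasure_image_le (d := 1) zero_le_one
  simp only [ENNReal.coe_one, ENNReal.one_rpow, one_mul] at h1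
  refine h1.trans ?_
  have hsub : φ '' s ⊆ Set.Icc 0 (φ b) := by
    rintro _ ⟨t, ht, rfl⟩
    constructor
    · exact variationOnFromTo.nonneg_of_le γ s ht.1
    · exact variationOnFromTo.monotoneOn hv ha ht hb ht.2
  refine (MeasureTheory.measure_mono hsub).trans ?_
  rw [MeasureTheory.hausdorffMeasure_real, Real.volume_Icc, sub_zero, hφ,
    variationOnFromTo.eq_of_le γ s hab]
  refine ENNReal.ofReal_toReal_le.trans ?_
  exact eVariationOn.mono γ Set.inter_subset_left

theorem aux_sum_le {X : Type*} [MetricSpace X] [MeasurableSpace X] [BorelSpace X]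
    (γ : ℝ → X) (hγ : Continuous γ) (a b : ℝ) (hinj : Set.InjOn γ (Set.Ico a b))
    (u : ℕ → ℝ) (hu : Monotone u) (hmem : ∀ i, u i ∈ Set.Icc a b) (n : ℕ) :
    ∑ i ∈ Finset.range n, edist (γ (u (i + 1))) (γ (u i)) ≤ μH[1] (γ '' Set.Ico a b) := by
  have hn : ∀ n, ∑ i ∈ Finset.range n, edist (γ (u (i + 1))) (γ (u i)) ≤
      μH[1] (γ '' Set.Ico a (u n)) := by
    intro n
    induction n with
    | zero => simp
    | succ k ih =>
      rw [Finset.sum_range_succ]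
      have hk : u k ≤ u (k + 1) := hu (Nat.le_succ k)
      have hsplit : Set.Ico a (u (k + 1)) = Set.Ico a (u k) ∪ Set.Ico (u k) (u (k + 1)) :=
        (Set.Ico_union_Ico_eq_Ico (hmem k).1 hk).symm
      have hI1 : Set.Ico a (u k) ⊆ Set.Ico a b := Set.Ico_subset_Ico_right (hmem k).2
      have hI2 : Set.Ico (u k) (u (k+1)) ⊆ Set.Ico a b :=
        Set.Ico_subset_Ico (hmem k).1 (hmem _).2
      have hdisj : Disjoint (γ '' Set.Ico a (u k)) (γ '' Set.Ico (u k) (u (k + 1))) := by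
        rw [Set.disjoint_left]
        rintro _ ⟨x, hx, rfl⟩ ⟨y, hy, hxy⟩
        have := hinj (hI2 hy) (hI1 hx) hxy
        subst this
        exact absurd hx.2 (not_lt.2 hy.1)
      have hm : MeasurableSet (γ '' Set.Ico (u k) (u (k + 1))) := by
        rcases eq_or_lt_of_le hk with h | h
        · simp [h]
        have : γ '' Set.Ico (u k) (u (k + 1)) =
            ⋃ m : ℕ, γ '' Set.Icc (u k) (u (k + 1) - 1 / ((m : ℝ) + 1)) := by
          rw [← Set.image_iUnion]
          congr 1
          ext t
          simp only [Set.mem_Ico, Set.mem_iUnion, Set.mem_Icc]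
          constructor
          · rintro ⟨h1, h2⟩
            obtain ⟨m, hm⟩ := exists_nat_one_div_lt (sub_pos.2 h2)
            exact ⟨m, h1, by linarith⟩
          · rintro ⟨m, h1, h2⟩
            have : 0 < 1 / ((m : ℝ) + 1) := by positivity
            exact ⟨h1, by linarith⟩
        rw [this]
        exact MeasurableSet.iUnion fun m => (isCompact_Icc.image hγ).isClosed.measurableSet
      rw [hsplit, Set.image_union, MeasureTheory.measure_union hdisj hm]
      refine add_le_add ih ?_
      rw [edist_comm]
      refine (aux_chord_le γ hγ _ _ hk).trans ((aux_Icc_le_Ioo γ _ _).trans ?_)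
      exact MeasureTheory.measure_mono (Set.image_mono Set.Ioo_subset_Ico_self)
  refine (hn n).trans (MeasureTheory.measure_mono (Set.image_mono ?_))
  exact Set.Ico_subset_Ico_right (hmem n).2



/-- An orthonormal frame of `ℝ³` whose distinguished axis is `o`. -/
structure AuxFrame (o e1 e2 : EuclideanSpace ℝ (Fin 3)) : Prop where
  oo : inner ℝ o o = 1
  aa : inner ℝ e1 e1 = 1
  bb : inner ℝ e2 e2 = 1
  oa : inner ℝ o e1 = 0
  ob : inner ℝ o e2 = 0
  ab : inner ℝ e1 e2 = 0
  expand : ∀ x : EuclideanSpace ℝ (Fin 3),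
    x = (inner ℝ e1 x) • e1 + (inner ℝ e2 x) • e2 + (inner ℝ o x) • o

/-- Sublinear functions whose zero sublevel set is a pointed closed convex cone with `o`
in its interior, normalised along the axis `o`. -/
structure AuxSL (o : EuclideanSpace ℝ (Fin 3)) (N : EuclideanSpace ℝ (Fin 3) → ℝ) : Prop where
  add : ∀ x y, N (x + y) ≤ N x + N y
  hom : ∀ c : ℝ, 0 < c → ∀ x, N (c • x) = c * N x
  shift : ∀ x (s : ℝ), N (x + s • o) = N x - s
  bound : ∃ M : ℝ, 0 ≤ M ∧ ∀ x, N x ≤ M * ‖x‖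
  pt : ∀ x, N x ≤ 0 → N (-x) ≤ 0 → x = 0

/-- The unit circle orthogonal to the axis. -/
def auxV (e1 e2 : EuclideanSpace ℝ (Fin 3)) (t : ℝ) : EuclideanSpace ℝ (Fin 3) :=
  Real.cos t • e1 + Real.sin t • e2

/-- The unnormalised boundary curve. -/
def auxW (o e1 e2 : EuclideanSpace ℝ (Fin 3)) (N : EuclideanSpace ℝ (Fin 3) → ℝ) (t : ℝ) :
    EuclideanSpace ℝ (Fin 3) :=
  auxV e1 e2 t + N (auxV e1 e2 t) • o

/-- The boundary curve on the sphere. -/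
def auxG (o e1 e2 : EuclideanSpace ℝ (Fin 3)) (N : EuclideanSpace ℝ (Fin 3) → ℝ) (t : ℝ) :
    EuclideanSpace ℝ (Fin 3) :=
  ‖auxW o e1 e2 N t‖⁻¹ • auxW o e1 e2 N t

/-- The boundary set on the sphere. -/
def auxD (N : EuclideanSpace ℝ (Fin 3) → ℝ) : Set (EuclideanSpace ℝ (Fin 3)) :=
  {x | ‖x‖ = 1 ∧ N x = 0}

theorem AuxSL.zero {o : EuclideanSpace ℝ (Fin 3)} {N : EuclideanSpace ℝ (Fin 3) → ℝ}
    (h : AuxSL o N) : N 0 = 0 := by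
  have := h.hom 2 (by norm_num) 0
  rw [smul_zero] at this
  linarith

theorem AuxSL.lip {o : EuclideanSpace ℝ (Fin 3)} {N : EuclideanSpace ℝ (Fin 3) → ℝ}
    (h : AuxSL o N) : ∃ M : NNReal, LipschitzWith M N := by
  obtain ⟨M, hM, hb⟩ := h.bound
  refine ⟨⟨M, hM⟩, LipschitzWith.of_le_add_mul _ fun x y => ?_⟩
  have h1 := h.add y (x - y)
  have h2 := hb (x - y)
  rw [add_sub_cancel] at h1
  rw [dist_eq_norm]
  change N x ≤ N y + M * ‖x - y‖
  linarith

theorem aux_normalize {x y : EuclideanSpace ℝ (Fin 3)} (hx : 1 ≤ ‖x‖) (hy : 1 ≤ ‖y‖) :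
    ‖‖x‖⁻¹ • x - ‖y‖⁻¹ • y‖ ≤ ‖x - y‖ := by
  have hx0 : 0 < ‖x‖ := by linarith
  have hy0 : 0 < ‖y‖ := by linarith
  refine le_of_sq_le_sq ?_ (norm_nonneg _)
  rw [norm_sub_sq_real, norm_sub_sq_real, norm_smul, norm_smul, inner_smul_left, inner_smul_right]
  simp only [norm_inv, norm_norm, inv_mul_cancel₀ hx0.ne', inv_mul_cancel₀ hy0.ne']
  simp only [conj_trivial]
  have hc := real_inner_le_norm x y
  set c := inner ℝ x y with hcdef
  have hk : c = (‖x‖ * ‖y‖) * (‖x‖⁻¹ * (‖y‖⁻¹ * c)) := by field_simp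
  set k := ‖x‖⁻¹ * (‖y‖⁻¹ * c) with hkdef
  have hk1 : k ≤ 1 := by
    have : k = c / (‖x‖ * ‖y‖) := by rw [hkdef]; field_simp
    rw [this, div_le_one (by positivity)]; exact hc
  rw [hk]
  have h1 : 1 ≤ ‖x‖ * ‖y‖ := by nlinarith
  nlinarith [sq_nonneg (‖x‖ - ‖y‖), mul_nonneg (sub_nonneg.2 h1) (sub_nonneg.2 hk1)]

section
variable {o e1 e2 : EuclideanSpace ℝ (Fin 3)} {N : EuclideanSpace ℝ (Fin 3) → ℝ}

theorem AuxFrame.ao (F : AuxFrame o e1 e2) : inner ℝ e1 o = 0 := by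
  rw [real_inner_comm]; exact F.oa
theorem AuxFrame.bo (F : AuxFrame o e1 e2) : inner ℝ e2 o = 0 := by
  rw [real_inner_comm]; exact F.ob
theorem AuxFrame.ba (F : AuxFrame o e1 e2) : inner ℝ e2 e1 = 0 := by
  rw [real_inner_comm]; exact F.ab

theorem AuxFrame.inner_o_V (F : AuxFrame o e1 e2) (t : ℝ) : inner ℝ o (auxV e1 e2 t) = 0 := by
  simp [auxV, inner_add_right, inner_smul_right, F.oa, F.ob]
theorem AuxFrame.inner_a_V (F : AuxFrame o e1 e2) (t : ℝ) :
    inner ℝ e1 (auxV e1 e2 t) = Real.cos t := by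
  simp only [auxV, inner_add_right, inner_smul_right, F.aa, F.ab]; ring
theorem AuxFrame.inner_b_V (F : AuxFrame o e1 e2) (t : ℝ) :
    inner ℝ e2 (auxV e1 e2 t) = Real.sin t := by
  simp only [auxV, inner_add_right, inner_smul_right, F.ba, F.bb]; ring
theorem AuxFrame.inner_V_V (F : AuxFrame o e1 e2) (t : ℝ) :
    inner ℝ (auxV e1 e2 t) (auxV e1 e2 t) = 1 := by
  nth_rewrite 1 [auxV]
  rw [inner_add_left, real_inner_smul_left, real_inner_smul_left, F.inner_a_V, F.inner_b_V]
  nlinarith [Real.sin_sq_add_cos_sq t]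

theorem AuxFrame.norm_W (F : AuxFrame o e1 e2) (N : EuclideanSpace ℝ (Fin 3) → ℝ) (t : ℝ) :
    1 ≤ ‖auxW o e1 e2 N t‖ := by
  have h : ‖auxW o e1 e2 N t‖ ^ 2 = 1 + N (auxV e1 e2 t) ^ 2 := by
    rw [← real_inner_self_eq_norm_sq, auxW]
    simp only [inner_add_left, inner_add_right, real_inner_smul_left, real_inner_smul_right,
      F.inner_V_V, F.inner_o_V, F.oo, real_inner_comm o (auxV e1 e2 t)]
    ring
  nlinarith [norm_nonneg (auxW o e1 e2 N t), sq_nonneg (N (auxV e1 e2 t))]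

theorem AuxFrame.norm_G (F : AuxFrame o e1 e2) (N : EuclideanSpace ℝ (Fin 3) → ℝ) (t : ℝ) :
    ‖auxG o e1 e2 N t‖ = 1 := by
  have := F.norm_W N t
  rw [auxG, norm_smul, norm_inv, norm_norm, inv_mul_cancel₀ (by linarith)]

theorem AuxFrame.norm_V (F : AuxFrame o e1 e2) (t : ℝ) : ‖auxV e1 e2 t‖ = 1 := by
  have h := F.inner_V_V t
  rw [real_inner_self_eq_norm_sq] at h
  nlinarith [norm_nonneg (auxV e1 e2 t)]

theorem AuxFrame.norm_o (F : AuxFrame o e1 e2) : ‖o‖ = 1 := by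
  have h := F.oo
  rw [real_inner_self_eq_norm_sq] at h
  nlinarith [norm_nonneg o]

theorem AuxFrame.V_lip (F : AuxFrame o e1 e2) : LipschitzWith 2 (auxV e1 e2) := by
  have h1 : ‖e1‖ = 1 := by
    have h := F.aa
    rw [real_inner_self_eq_norm_sq] at h
    nlinarith [norm_nonneg e1]
  have h2 : ‖e2‖ = 1 := by
    have h := F.bb
    rw [real_inner_self_eq_norm_sq] at h
    nlinarith [norm_nonneg e2]
  refine LipschitzWith.of_dist_le_mul fun s t => ?_
  rw [dist_eq_norm, Real.dist_eq]
  have : auxV e1 e2 s - auxV e1 e2 t =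
      (Real.cos s - Real.cos t) • e1 + (Real.sin s - Real.sin t) • e2 := by
    simp only [auxV]; module
  rw [this]
  refine (norm_add_le _ _).trans ?_
  rw [norm_smul, norm_smul, h1, h2, Real.norm_eq_abs, Real.norm_eq_abs]
  have hc : |Real.cos s - Real.cos t| ≤ |s - t| := by
    have := Real.lipschitzWith_cos.dist_le_mul s t
    simpa [Real.dist_eq] using this
  have hs : |Real.sin s - Real.sin t| ≤ |s - t| := by
    have := Real.lipschitzWith_sin.dist_le_mul s t
    simpa [Real.dist_eq] using this
  simp only [NNReal.coe_ofNat]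
  linarith

theorem AuxSL.G_lip (h : AuxSL o N) (F : AuxFrame o e1 e2) :
    ∃ M : NNReal, LipschitzWith M (auxG o e1 e2 N) := by
  obtain ⟨M, hM⟩ := h.lip
  refine ⟨2 + M * 2, LipschitzWith.of_dist_le_mul fun s t => ?_⟩
  rw [dist_eq_norm]
  refine (aux_normalize (F.norm_W N s) (F.norm_W N t)).trans ?_
  have hV := F.V_lip.dist_le_mul s t
  have hN := (hM.comp F.V_lip).dist_le_mul s t
  have : auxW o e1 e2 N s - auxW o e1 e2 N t = (auxV e1 e2 s - auxV e1 e2 t) +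
      (N (auxV e1 e2 s) - N (auxV e1 e2 t)) • o := by
    simp only [auxW]; module
  rw [this]
  refine (norm_add_le _ _).trans ?_
  rw [norm_smul, F.norm_o, mul_one, ← dist_eq_norm, ← dist_eq_norm]
  push_cast
  push_cast at hV hN
  simp only [Function.comp] at hN
  linarith

theorem auxV_periodic : Function.Periodic (auxV e1 e2) (2 * Real.pi) := by
  intro t; simp [auxV]

theorem auxG_periodic : Function.Periodic (auxG o e1 e2 N) (2 * Real.pi) := by
  intro t
  simp only [auxG, auxW, auxV_periodic t]

theorem auxV_add_pi (t : ℝ) : auxV e1 e2 (t + Real.pi) = -auxV e1 e2 t := by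
  simp only [auxV, Real.cos_add_pi, Real.sin_add_pi]; module

theorem AuxFrame.G_injOn (F : AuxFrame o e1 e2) (N : EuclideanSpace ℝ (Fin 3) → ℝ) (a : ℝ) :
    Set.InjOn (auxG o e1 e2 N) (Set.Ico a (a + 2 * Real.pi)) := by
  intro s hs t ht hst
  have h1 : ∀ r, inner ℝ e1 (auxG o e1 e2 N r) = ‖auxW o e1 e2 N r‖⁻¹ * Real.cos r := by
    intro r
    rw [auxG, real_inner_smul_right]
    congr 1
    rw [auxW, inner_add_right, real_inner_smul_right, F.inner_a_V, F.ao]; ring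
  have h2 : ∀ r, inner ℝ e2 (auxG o e1 e2 N r) = ‖auxW o e1 e2 N r‖⁻¹ * Real.sin r := by
    intro r
    rw [auxG, real_inner_smul_right]
    congr 1
    rw [auxW, inner_add_right, real_inner_smul_right, F.inner_b_V, F.bo]; ring
  have hc : ‖auxW o e1 e2 N s‖⁻¹ * Real.cos s = ‖auxW o e1 e2 N t‖⁻¹ * Real.cos t := by
    rw [← h1, ← h1, hst]
  have hd : ‖auxW o e1 e2 N s‖⁻¹ * Real.sin s = ‖auxW o e1 e2 N t‖⁻¹ * Real.sin t := by
    rw [← h2, ← h2, hst]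
  have p1 : 0 < ‖auxW o e1 e2 N s‖⁻¹ := inv_pos.2 (by linarith [F.norm_W N s])
  have p2 : 0 < ‖auxW o e1 e2 N t‖⁻¹ := inv_pos.2 (by linarith [F.norm_W N t])
  set r := ‖auxW o e1 e2 N s‖⁻¹
  set q := ‖auxW o e1 e2 N t‖⁻¹
  have hrq : r = q := by
    have e1 : r ^ 2 = (r * Real.cos s) ^ 2 + (r * Real.sin s) ^ 2 := by
      nlinarith [Real.sin_sq_add_cos_sq s]
    have e2 : q ^ 2 = (q * Real.cos t) ^ 2 + (q * Real.sin t) ^ 2 := by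
      nlinarith [Real.sin_sq_add_cos_sq t]
    rw [hc, hd, ← e2] at e1
    nlinarith
  rw [hrq] at hc hd
  have hc' := mul_left_cancel₀ p2.ne' hc
  have hd' := mul_left_cancel₀ p2.ne' hd
  have hang := Real.Angle.cos_sin_inj hc' hd'
  rw [Real.Angle.angle_eq_iff_two_pi_dvd_sub] at hang
  obtain ⟨k, hk⟩ := hang
  have hpi := Real.pi_pos
  have k1 : (k : ℝ) < 1 := by
    have := hs.2; have := ht.1
    by_contra hcon
    push Not at hcon
    nlinarith
  have k2 : (-1 : ℝ) < k := by
    have := hs.1; have := ht.2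
    by_contra hcon
    push Not at hcon
    nlinarith
  have k1' : k < 1 := by exact_mod_cast k1
  have k2' : -1 < k := by exact_mod_cast k2
  have : k = 0 := by omega
  rw [this] at hk
  simp at hk
  linarith

theorem AuxSL.N_W (h : AuxSL o N) (t : ℝ) : N (auxW o e1 e2 N t) = 0 := by
  rw [auxW, h.shift, sub_self]

theorem AuxSL.N_G (h : AuxSL o N) (F : AuxFrame o e1 e2) (t : ℝ) : N (auxG o e1 e2 N t) = 0 := by
  have := F.norm_W N t
  rw [auxG, h.hom _ (inv_pos.2 (by linarith)), h.N_W, mul_zero]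

theorem AuxFrame.polar (F : AuxFrame o e1 e2) (x : EuclideanSpace ℝ (Fin 3)) :
    ∃ r t : ℝ, 0 ≤ r ∧ x = r • auxV e1 e2 t + (inner ℝ o x) • o := by
  set z : ℂ := ⟨inner ℝ e1 x, inner ℝ e2 x⟩ with hz
  refine ⟨‖z‖, z.arg, norm_nonneg _, ?_⟩
  have hc : ‖z‖ * Real.cos z.arg = inner ℝ e1 x := Complex.norm_mul_cos_arg z
  have hs : ‖z‖ * Real.sin z.arg = inner ℝ e2 x := Complex.norm_mul_sin_arg z
  rw [auxV, smul_add, smul_smul, smul_smul, hc, hs]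
  exact F.expand x

theorem AuxSL.image_G (h : AuxSL o N) (F : AuxFrame o e1 e2) (a : ℝ) :
    auxG o e1 e2 N '' Set.Ico a (a + 2 * Real.pi) = auxD N := by
  ext x
  constructor
  · rintro ⟨t, -, rfl⟩
    exact ⟨F.norm_G N t, h.N_G F t⟩
  · rintro ⟨hx, hN⟩
    obtain ⟨r, t, hr, hxt⟩ := F.polar x
    rcases eq_or_lt_of_le hr with h0 | h0
    · rw [← h0, zero_smul] at hxt
      rw [hxt, h.shift, h.zero] at hN
      have : (inner ℝ o x : ℝ) = 0 := by linarith
      rw [this] at hxt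
      rw [hxt] at hx
      simp at hx
    · have hs : r * N (auxV e1 e2 t) = inner ℝ o x := by
        rw [hxt, h.shift, h.hom r h0] at hN
        linarith
      have hxW : x = r • auxW o e1 e2 N t := by
        rw [auxW, smul_add, smul_smul, hs]; exact hxt
      have hG : auxG o e1 e2 N t = x := by
        rw [hxW, norm_smul, Real.norm_of_nonneg hr] at hx
        rw [auxG, hxW]
        congr 1
        exact inv_eq_of_mul_eq_one_left hx
      obtain ⟨s, hs, hs'⟩ := (auxG_periodic (o := o) (e1 := e1) (e2 := e2) (N := N)).exists_mem_Ico
        Real.two_pi_pos t a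
      exact ⟨s, hs, by rw [← hs', hG]⟩

theorem AuxSL.cutMax (h : AuxSL o N) (l : EuclideanSpace ℝ (Fin 3) →ₗ[ℝ] ℝ) (hl : l o = -1) :
    AuxSL o (fun x => max (N x) (l x)) where
  add x y := by
    have := h.add x y
    rw [map_add]
    exact max_le (this.trans (add_le_add (le_max_left _ _) (le_max_left _ _)))
      (add_le_add (le_max_right _ _) (le_max_right _ _))
  hom c hc x := by
    simp only [h.hom c hc, map_smul, smul_eq_mul]
    exact (mul_max_of_nonneg _ _ hc.le).symm
  shift x s := by
    simp only [h.shift, map_add, map_smul, hl, smul_eq_mul]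
    rw [show l x + s * -1 = l x - s by ring, max_sub_sub_right]
  bound := by
    obtain ⟨M, hM, hb⟩ := h.bound
    refine ⟨M + ‖LinearMap.toContinuousLinearMap l‖, by positivity, fun x => ?_⟩
    have h1 := hb x
    have h2 := (LinearMap.toContinuousLinearMap l).le_opNorm x
    have h3 : l x ≤ ‖LinearMap.toContinuousLinearMap l‖ * ‖x‖ := (le_abs_self _).trans h2
    have : 0 ≤ M * ‖x‖ := by positivity
    have : 0 ≤ ‖LinearMap.toContinuousLinearMap l‖ * ‖x‖ := by positivity
    rw [add_mul]
    exact max_le (by linarith) (by linarith)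
  pt x h1 h2 := h.pt x ((le_max_left _ _).trans h1) ((le_max_left _ _).trans h2)

theorem AuxSL.support (h : AuxSL o N) (x0 : EuclideanSpace ℝ (Fin 3)) (hx0 : x0 ≠ 0) :
    ∃ l : EuclideanSpace ℝ (Fin 3) →ₗ[ℝ] ℝ, l o = -1 ∧ (∀ x, l x ≤ N x) ∧ l x0 = N x0 := by
  obtain ⟨g, hg1, hg2⟩ := exists_extension_of_le_sublinear
    (LinearPMap.mkSpanSingleton x0 (N x0) hx0) N h.hom h.add (by
      rintro ⟨y, hy⟩
      obtain ⟨c, rfl⟩ := Submodule.mem_span_singleton.1 hy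
      rw [LinearPMap.mkSpanSingleton'_apply]
      simp only [smul_eq_mul, RingHom.id_apply]
      rcases lt_trichotomy c 0 with hc | hc | hc
      · have h1 := h.hom (-c) (by linarith) x0
        have h2 := h.add (c • x0) ((-c) • x0)
        rw [← add_smul, add_neg_cancel, zero_smul, h.zero] at h2
        linarith
      · simp [hc, h.zero]
      · rw [h.hom c hc])
  refine ⟨g, ?_, hg2, ?_⟩
  · have h1 := hg2 o
    have h2 := hg2 (-o)
    have h3 := h.shift 0 1
    have h4 := h.shift 0 (-1)
    simp only [one_smul, neg_smul, zero_add, h.zero] at h3 h4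
    rw [map_neg] at h2
    linarith
  · have := hg1 ⟨x0, Submodule.mem_span_singleton_self x0⟩
    rw [LinearPMap.mkSpanSingleton_apply] at this
    exact this

end



theorem aux_split (γ : ℝ → EuclideanSpace ℝ (Fin 3)) (hγ : Continuous γ) (a b c : ℝ)
    (hab : a ≤ b) (hbc : b ≤ c) (hinj : Set.InjOn γ (Set.Ico a c)) :
    μH[1] (γ '' Set.Ico a c) = μH[1] (γ '' Set.Ico a b) + μH[1] (γ '' Set.Ico b c) := by
  have hI1 : Set.Ico a b ⊆ Set.Ico a c := Set.Ico_subset_Ico_right hbc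
  have hI2 : Set.Ico b c ⊆ Set.Ico a c := Set.Ico_subset_Ico_left hab
  have hdisj : Disjoint (γ '' Set.Ico a b) (γ '' Set.Ico b c) := by
    rw [Set.disjoint_left]
    rintro _ ⟨x, hx, rfl⟩ ⟨y, hy, hxy⟩
    have := hinj (hI2 hy) (hI1 hx) hxy
    subst this
    exact absurd hx.2 (not_lt.2 hy.1)
  have hm : MeasurableSet (γ '' Set.Ico b c) :=
    measurableSet_Ico.image_of_continuousOn_injOn hγ.continuousOn (hinj.mono hI2)
  rw [← Set.Ico_union_Ico_eq_Ico hab hbc, Set.image_union, MeasureTheory.measure_union hdisj hm]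

/-- Rolling a point of the sphere onto the great half circle from `p` in direction `e`. -/
def auxF (p e x : EuclideanSpace ℝ (Fin 3)) : EuclideanSpace ℝ (Fin 3) :=
  (inner ℝ p x : ℝ) • p + Real.sqrt (1 - (inner ℝ p x : ℝ) ^ 2) • e

theorem auxF_lip (p e : EuclideanSpace ℝ (Fin 3)) (hp : ‖p‖ = 1) (he : ‖e‖ = 1)
    (hpe : inner ℝ p e = 0) : LipschitzOnWith 1 (auxF p e) {x | ‖x‖ = 1} := by
  refine LipschitzOnWith.of_dist_le_mul ?_
  intro x hx y hy
  simp only [Set.mem_ofPred_eq] at hx hy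
  rw [NNReal.coe_one, one_mul, dist_eq_norm, dist_eq_norm]
  refine le_of_sq_le_sq ?_ (norm_nonneg _)
  have hpp : inner ℝ p p = 1 := by rw [real_inner_self_eq_norm_sq, hp]; norm_num
  have hee : inner ℝ e e = 1 := by rw [real_inner_self_eq_norm_sq, he]; norm_num
  have hep : inner ℝ e p = 0 := by rw [real_inner_comm]; exact hpe
  have hxx : inner ℝ x x = 1 := by rw [real_inner_self_eq_norm_sq, hx]; norm_num
  have hyy : inner ℝ y y = 1 := by rw [real_inner_self_eq_norm_sq, hy]; norm_num
  set a : ℝ := inner ℝ p x with ha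
  set b : ℝ := inner ℝ p y with hb
  have hax : inner ℝ x p = a := real_inner_comm _ _
  have hby : inner ℝ y p = b := real_inner_comm _ _
  have h1 : ‖x - a • p‖ ^ 2 = 1 - a ^ 2 := by
    rw [← real_inner_self_eq_norm_sq]
    simp only [inner_sub_left, inner_sub_right, real_inner_smul_left, real_inner_smul_right,
      hpp, hxx, hax, ← ha]
    ring
  have h2 : ‖y - b • p‖ ^ 2 = 1 - b ^ 2 := by
    rw [← real_inner_self_eq_norm_sq]
    simp only [inner_sub_left, inner_sub_right, real_inner_smul_left, real_inner_smul_right,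
      hpp, hyy, hby, ← hb]
    ring
  have h3 : inner ℝ (x - a • p) (y - b • p) = inner ℝ x y - a * b := by
    simp only [inner_sub_left, inner_sub_right, real_inner_smul_left, real_inner_smul_right,
      hpp, hax, ← hb]
    ring
  have h4 := real_inner_le_norm (x - a • p) (y - b • p)
  have e1 : Real.sqrt (1 - a ^ 2) = ‖x - a • p‖ := by rw [← h1, Real.sqrt_sq (norm_nonneg _)]
  have e2 : Real.sqrt (1 - b ^ 2) = ‖y - b • p‖ := by rw [← h2, Real.sqrt_sq (norm_nonneg _)]
  have hd : auxF p e x - auxF p e y = (a - b) • p + (‖x - a • p‖ - ‖y - b • p‖) • e := by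
    simp only [auxF, ← ha, ← hb, e1, e2]; module
  have hsq : ‖auxF p e x - auxF p e y‖ ^ 2 = (a - b) ^ 2 + (‖x - a • p‖ - ‖y - b • p‖) ^ 2 := by
    rw [hd, ← real_inner_self_eq_norm_sq]
    simp only [inner_add_left, inner_add_right, real_inner_smul_left, real_inner_smul_right,
      hpp, hee, hpe, hep]
    ring
  rw [hsq, norm_sub_sq_real, hx, hy]
  rw [h3] at h4
  nlinarith

theorem aux_arc_le (S A : Set (EuclideanSpace ℝ (Fin 3))) (p q x : EuclideanSpace ℝ (Fin 3))
    (hS : IsPreconnected S) (hS1 : ∀ y ∈ S, ‖y‖ = 1) (hpS : p ∈ S) (hxS : x ∈ S)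
    (hq : q - (inner ℝ p q : ℝ) • p ≠ 0)
    (hA : ∀ y ∈ A, ‖y‖ = 1 ∧ (∃ α β : ℝ, 0 ≤ β ∧ y = α • p + β • q) ∧
      (inner ℝ p x : ℝ) ≤ inner ℝ p y) :
    μH[1] A ≤ μH[1] S := by
  have hp : ‖p‖ = 1 := hS1 p hpS
  have hpp : inner ℝ p p = 1 := by rw [real_inner_self_eq_norm_sq, hp]; norm_num
  set w := q - (inner ℝ p q : ℝ) • p with hw
  have hwn : 0 < ‖w‖ := norm_pos_iff.2 hq
  set e := ‖w‖⁻¹ • w with he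
  have hwe : w = ‖w‖ • e := by rw [he, smul_smul, mul_inv_cancel₀ hwn.ne', one_smul]
  have he1 : ‖e‖ = 1 := by rw [he, norm_smul, norm_inv, norm_norm, inv_mul_cancel₀ hwn.ne']
  have hpw : inner ℝ p w = 0 := by
    rw [hw, inner_sub_right, real_inner_smul_right, hpp]; ring
  have hpe : inner ℝ p e = 0 := by rw [he, real_inner_smul_right, hpw, mul_zero]
  have hee : inner ℝ e e = 1 := by rw [real_inner_self_eq_norm_sq, he1]; norm_num
  have hep : inner ℝ e p = 0 := by rw [real_inner_comm]; exact hpe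
  have hfix : ∀ y ∈ A, auxF p e y = y := by
    intro y hy
    obtain ⟨hy1, ⟨α, β, hβ, hyd⟩, -⟩ := hA y hy
    have h1 : y = (inner ℝ p y : ℝ) • p + (β * ‖w‖) • e := by
      have : (inner ℝ p y : ℝ) = α + β * inner ℝ p q := by
        rw [hyd, inner_add_right, real_inner_smul_right, real_inner_smul_right, hpp]; ring
      rw [this, mul_smul, ← hwe, hw, hyd]; module
    have h2 : 1 - (inner ℝ p y : ℝ) ^ 2 = (β * ‖w‖) ^ 2 := by
      have hyy : inner ℝ y y = 1 := by rw [real_inner_self_eq_norm_sq, hy1]; norm_num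
      set c : ℝ := inner ℝ p y
      rw [h1] at hyy
      simp only [inner_add_left, inner_add_right, real_inner_smul_left, real_inner_smul_right,
        hpp, hee, hpe, hep] at hyy
      linarith
    rw [auxF, h2, Real.sqrt_sq (by positivity)]
    exact h1.symm
  have hsub : A ⊆ auxF p e '' S := by
    intro y hy
    have hc : ContinuousOn (fun z : EuclideanSpace ℝ (Fin 3) => (inner ℝ p z : ℝ)) S :=
      (continuous_const.inner continuous_id).continuousOn
    have hiv := hS.intermediate_value hxS hpS hc
    obtain ⟨z, hz, hzy⟩ := hiv (show (inner ℝ p y : ℝ) ∈ Set.Icc (inner ℝ p x : ℝ) (inner ℝ p p) by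
      refine ⟨(hA y hy).2.2, ?_⟩
      have := real_inner_le_norm p y
      rw [hp, (hA y hy).1] at this
      rw [hpp]; linarith)
    refine ⟨z, hz, ?_⟩
    simp only at hzy
    rw [auxF, hzy, ← auxF, hfix y hy]
  have hL := ((auxF_lip p e hp he1 hpe).mono (s := S) hS1).hausdorffMeasure_image_le
    (d := 1) zero_le_one
  simp only [ENNReal.coe_one, ENNReal.one_rpow, one_mul] at hL
  exact (MeasureTheory.measure_mono hsub).trans hL

section
variable {o e1 e2 : EuclideanSpace ℝ (Fin 3)} {N M : EuclideanSpace ℝ (Fin 3) → ℝ}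

theorem auxV_trig (a b t : ℝ) : Real.sin (b - a) • auxV e1 e2 t =
    Real.sin (b - t) • auxV e1 e2 a + Real.sin (t - a) • auxV e1 e2 b := by
  have h1 : Real.sin (b - a) * Real.cos t =
    Real.sin (b - t) * Real.cos a + Real.sin (t - a) * Real.cos b := by
    simp only [Real.sin_sub]; ring
  have h2 : Real.sin (b - a) * Real.sin t =
    Real.sin (b - t) * Real.sin a + Real.sin (t - a) * Real.sin b := by
    simp only [Real.sin_sub]; ring
  simp only [auxV, smul_add, smul_smul, h1, h2]
  module

theorem AuxSL.cut_struct (h : AuxSL o N) (F : AuxFrame o e1 e2)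
    (l : EuclideanSpace ℝ (Fin 3) →ₗ[ℝ] ℝ) (t0 : ℝ)
    (ht0 : N (auxV e1 e2 t0) < l (auxV e1 e2 t0)) :
    ∃ a b, a < t0 ∧ t0 < b ∧ b < a + Real.pi ∧ N (auxV e1 e2 a) = l (auxV e1 e2 a) ∧
      N (auxV e1 e2 b) = l (auxV e1 e2 b) ∧
      (∀ t ∈ Set.Icc a b, N (auxV e1 e2 t) ≤ l (auxV e1 e2 t)) ∧
      (∀ t ∈ Set.Icc b (a + 2 * Real.pi), l (auxV e1 e2 t) ≤ N (auxV e1 e2 t)) := by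
  have hpi := Real.pi_pos
  set g : ℝ → ℝ := fun t => N (auxV e1 e2 t) - l (auxV e1 e2 t) with hg
  have hgc : Continuous g := by
    obtain ⟨K, hK⟩ := h.lip
    exact (hK.continuous.comp F.V_lip.continuous).sub
      (l.continuous_of_finiteDimensional.comp F.V_lip.continuous)
  have hper : ∀ t, g (t + 2 * Real.pi) = g t := by
    intro t
    simp only [hg, auxV_periodic t]
  have hpos : ∀ t, 0 < g t + g (t + Real.pi) := by
    intro t
    simp only [hg, auxV_add_pi, map_neg]
    have h1 : 0 < N (auxV e1 e2 t) + N (-auxV e1 e2 t) := by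
      by_contra hcon
      push Not at hcon
      have hx : N (auxW o e1 e2 N t) ≤ 0 := (h.N_W t).le
      have hx' : N (-auxW o e1 e2 N t) ≤ 0 := by
        rw [auxW, neg_add, ← neg_smul, h.shift]; linarith
      have h0 := h.pt _ hx hx'
      have := F.norm_W N t
      rw [h0, norm_zero] at this
      linarith
    linarith
  have hg0 : g t0 < 0 := by simp only [hg]; linarith
  have hgR : 0 < g (t0 + Real.pi) := by linarith [hpos t0]
  have hgL : 0 < g (t0 - Real.pi) := by
    have := hper (t0 - Real.pi)
    rw [show t0 - Real.pi + 2 * Real.pi = t0 + Real.pi by ring] at this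
    linarith
  have hconv : ∀ s t r, s < t → t < r → r < s + Real.pi → g s < 0 → g r < 0 → g t < 0 := by
    intro s t r hst htr hrs hs hr
    have p0 : 0 < Real.sin (r - s) := Real.sin_pos_of_pos_of_lt_pi (by linarith) (by linarith)
    have p1 : 0 < Real.sin (r - t) := Real.sin_pos_of_pos_of_lt_pi (by linarith) (by linarith)
    have p2 : 0 < Real.sin (t - s) := Real.sin_pos_of_pos_of_lt_pi (by linarith) (by linarith)
    have hv := auxV_trig (e1 := e1) (e2 := e2) s r t
    have hN := h.add (Real.sin (r - t) • auxV e1 e2 s) (Real.sin (t - s) • auxV e1 e2 r)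
    rw [← hv, h.hom _ p0, h.hom _ p1, h.hom _ p2] at hN
    have hl : Real.sin (r - s) * l (auxV e1 e2 t) =
        Real.sin (r - t) * l (auxV e1 e2 s) + Real.sin (t - s) * l (auxV e1 e2 r) := by
      rw [← smul_eq_mul, ← smul_eq_mul, ← smul_eq_mul, ← map_smul, ← map_smul, ← map_smul,
        ← map_add, hv]
    have h1 : Real.sin (r - s) * g t ≤ Real.sin (r - t) * g s + Real.sin (t - s) * g r := by
      simp only [hg]; linarith
    have h2 := mul_pos_of_neg_of_neg (neg_neg_of_pos p1) hs
    have h3 := mul_pos_of_neg_of_neg (neg_neg_of_pos p2) hr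
    by_contra hcon
    push Not at hcon
    have := mul_nonneg p0.le hcon
    linarith
  have hb : ∃ b, t0 < b ∧ b < t0 + Real.pi ∧ g b = 0 ∧ ∀ t ∈ Set.Ico t0 b, g t < 0 := by
    have hcomp : IsCompact (Set.Icc t0 (t0 + Real.pi) ∩ {t | 0 ≤ g t}) :=
      isCompact_Icc.inter_right (isClosed_le continuous_const hgc)
    obtain ⟨b, ⟨hb1, hb2⟩, hb3⟩ := hcomp.exists_isLeast
      ⟨t0 + Real.pi, ⟨by linarith, le_rfl⟩, hgR.le⟩
    have hb2' : 0 ≤ g b := hb2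
    have hneg : ∀ t ∈ Set.Ico t0 b, g t < 0 := by
      intro t ht
      by_contra hcon
      push Not at hcon
      have := hb3 ⟨⟨ht.1, ht.2.le.trans hb1.2⟩, hcon⟩
      exact absurd ht.2 (not_lt.2 this)
    have hne : t0 < b := by
      rcases eq_or_lt_of_le hb1.1 with h1 | h1
      · rw [← h1] at hb2'; linarith
      · exact h1
    have hb0 : g b ≤ 0 := by
      have hcl : b ∈ closure (Set.Ico t0 b) := by
        rw [closure_Ico hne.ne]; exact ⟨hne.le, le_rfl⟩
      have : closure (Set.Ico t0 b) ⊆ {t | g t ≤ 0} :=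
        closure_minimal (fun t ht => (hneg t ht).le) (isClosed_le hgc continuous_const)
      exact this hcl
    have hb00 : g b = 0 := le_antisymm hb0 hb2'
    refine ⟨b, hne, lt_of_le_of_ne hb1.2 ?_, hb00, hneg⟩
    rintro rfl
    linarith
  have ha : ∃ a, t0 - Real.pi < a ∧ a < t0 ∧ g a = 0 ∧ ∀ t ∈ Set.Ioc a t0, g t < 0 := by
    have hcomp : IsCompact (Set.Icc (t0 - Real.pi) t0 ∩ {t | 0 ≤ g t}) :=
      isCompact_Icc.inter_right (isClosed_le continuous_const hgc)
    obtain ⟨b, ⟨hb1, hb2⟩, hb3⟩ := hcomp.exists_isGreatest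
      ⟨t0 - Real.pi, ⟨le_rfl, by linarith⟩, hgL.le⟩
    have hb2' : 0 ≤ g b := hb2
    have hneg : ∀ t ∈ Set.Ioc b t0, g t < 0 := by
      intro t ht
      by_contra hcon
      push Not at hcon
      have := hb3 ⟨⟨hb1.1.trans ht.1.le, ht.2⟩, hcon⟩
      exact absurd ht.1 (not_lt.2 this)
    have hne : b < t0 := by
      rcases eq_or_lt_of_le hb1.2 with h1 | h1
      · rw [h1] at hb2'; linarith
      · exact h1
    have hb0 : g b ≤ 0 := by
      have hcl : b ∈ closure (Set.Ioc b t0) := by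
        rw [closure_Ioc hne.ne]; exact ⟨le_rfl, hne.le⟩
      have : closure (Set.Ioc b t0) ⊆ {t | g t ≤ 0} :=
        closure_minimal (fun t ht => (hneg t ht).le) (isClosed_le hgc continuous_const)
      exact this hcl
    have hb00 : g b = 0 := le_antisymm hb0 hb2'
    refine ⟨b, lt_of_le_of_ne hb1.1 ?_, hne, hb00, hneg⟩
    rintro rfl
    linarith
  obtain ⟨b, hb1, hb2, hb3, hb4⟩ := hb
  obtain ⟨a, ha1, ha2, ha3, ha4⟩ := ha
  have hbet : ∀ t ∈ Set.Icc a b, g t ≤ 0 := by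
    intro t ht
    rcases eq_or_lt_of_le ht.1 with h1 | h1
    · rw [← h1, ha3]
    rcases eq_or_lt_of_le ht.2 with h2 | h2
    · rw [h2, hb3]
    rcases le_total t t0 with h3 | h3
    · exact (ha4 t ⟨h1, h3⟩).le
    · exact (hb4 t ⟨h3, h2⟩).le
  have hbap : b < a + Real.pi := by
    by_contra hcon
    push Not at hcon
    have h1 := hpos a
    have h2 := hbet (a + Real.pi) ⟨by linarith, hcon⟩
    linarith
  refine ⟨a, b, ha2, hb1, hbap, by simp only [hg] at ha3; linarith,
    by simp only [hg] at hb3; linarith, fun t ht => ?_, fun t ht => ?_⟩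
  · have := hbet t ht
    simp only [hg] at this; linarith
  · suffices 0 ≤ g t by simp only [hg] at this; linarith
    by_contra hcon
    push Not at hcon
    have htb : b < t := by
      rcases eq_or_lt_of_le ht.1 with h1 | h1
      · rw [← h1, hb3] at hcon; linarith
      · exact h1
    have hta : t < a + 2 * Real.pi := by
      rcases eq_or_lt_of_le ht.2 with h1 | h1
      · rw [h1, hper, ha3] at hcon; linarith
      · exact h1
    rcases lt_trichotomy t (t0 + Real.pi) with h1 | h1 | h1
    · have := hconv t0 b t hb1 htb h1 hg0 hcon
      linarith
    · rw [h1] at hcon; linarith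
    · have hcon' : g (t - 2 * Real.pi) < 0 := by
        have := hper (t - 2 * Real.pi)
        rw [sub_add_cancel] at this
        linarith
      have := hconv (t - 2 * Real.pi) a t0 (by linarith) ha2 (by linarith) hcon' hg0
      linarith

end



section
variable {o e1 e2 : EuclideanSpace ℝ (Fin 3)} {N M : EuclideanSpace ℝ (Fin 3) → ℝ}

theorem AuxSL.finite_arc (h : AuxSL o N) (F : AuxFrame o e1 e2) (a b : ℝ) :
    μH[1] (auxG o e1 e2 N '' Set.Icc a b) < ⊤ := by
  obtain ⟨K, hK⟩ := h.G_lip F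
  refine (hK.hausdorffMeasure_image_le (d := 1) zero_le_one (Set.Icc a b)).trans_lt ?_
  rw [MeasureTheory.hausdorffMeasure_real, Real.volume_Icc, ENNReal.rpow_one]
  exact ENNReal.mul_lt_top ENNReal.coe_lt_top ENNReal.ofReal_lt_top

theorem AuxSL.arc_strict (h : AuxSL o N) (hM : AuxSL o M) (F : AuxFrame o e1 e2)
    (l : EuclideanSpace ℝ (Fin 3) →ₗ[ℝ] ℝ) (hl : l o = -1) (a t0 b : ℝ)
    (hat : a < t0) (htb : t0 < b) (hba : b < a + Real.pi)
    (ht0 : N (auxV e1 e2 t0) < l (auxV e1 e2 t0))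
    (hNa : N (auxV e1 e2 a) = l (auxV e1 e2 a)) (hNb : N (auxV e1 e2 b) = l (auxV e1 e2 b))
    (hMl : ∀ t ∈ Set.Icc a b, M (auxV e1 e2 t) = l (auxV e1 e2 t)) :
    μH[1] (auxG o e1 e2 M '' Set.Icc a b) < μH[1] (auxG o e1 e2 N '' Set.Icc a b) := by
  have hpi := Real.pi_pos
  have hab : a < b := hat.trans htb
  obtain ⟨K, hK⟩ := h.G_lip F
  obtain ⟨K', hK'⟩ := hM.G_lip F
  have hcN := hK.continuous
  have hcM := hK'.continuous
  set γ := auxG o e1 e2 N with hγ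
  set σ := auxG o e1 e2 M with hσ
  have hγ1 : ∀ t, ‖γ t‖ = 1 := F.norm_G N
  have hσ1 : ∀ t, ‖σ t‖ = 1 := F.norm_G M
  have hpa : σ a = γ a := by
    simp only [hγ, hσ, auxG, auxW, hMl a ⟨le_rfl, hab.le⟩, hNa]
  have hqb : σ b = γ b := by
    simp only [hγ, hσ, auxG, auxW, hMl b ⟨hab.le, le_rfl⟩, hNb]
  set p := γ a with hp
  set q := γ b with hq
  set x := γ t0 with hx
  have hsin : 0 < Real.sin (b - a) := Real.sin_pos_of_pos_of_lt_pi (by linarith) (by linarith)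
  -- points of the arc are nonnegative combinations of the end points
  have hcomb : ∀ t ∈ Set.Icc a b, ∃ α β : ℝ, 0 ≤ α ∧ 0 ≤ β ∧ σ t = α • p + β • q := by
    intro t ht
    have hWW : Real.sin (b - a) • auxW o e1 e2 M t = Real.sin (b - t) • auxW o e1 e2 M a +
        Real.sin (t - a) • auxW o e1 e2 M b := by
      have hv := auxV_trig (e1 := e1) (e2 := e2) a b t
      have hl' : Real.sin (b - a) * l (auxV e1 e2 t) =
        Real.sin (b - t) * l (auxV e1 e2 a) + Real.sin (t - a) * l (auxV e1 e2 b) := by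
        rw [← smul_eq_mul, ← smul_eq_mul, ← smul_eq_mul, ← map_smul, ← map_smul, ← map_smul,
          ← map_add, hv]
      simp only [auxW, hMl t ht, hMl a ⟨le_rfl, hab.le⟩, hMl b ⟨hab.le, le_rfl⟩]
      rw [smul_add, hv, smul_smul, hl']
      module
    have hs1 : 0 ≤ Real.sin (b - t) :=
      Real.sin_nonneg_of_nonneg_of_le_pi (by linarith [ht.2]) (by linarith [ht.1])
    have hs2 : 0 ≤ Real.sin (t - a) :=
      Real.sin_nonneg_of_nonneg_of_le_pi (by linarith [ht.1]) (by linarith [ht.2])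
    have na := F.norm_W M a
    have nb := F.norm_W M b
    have nt := F.norm_W M t
    have hWa : auxW o e1 e2 M a = ‖auxW o e1 e2 M a‖ • p := by
      rw [← hpa, hσ, auxG, smul_smul, mul_inv_cancel₀ (by linarith), one_smul]
    have hWb : auxW o e1 e2 M b = ‖auxW o e1 e2 M b‖ • q := by
      rw [← hqb, hσ, auxG, smul_smul, mul_inv_cancel₀ (by linarith), one_smul]
    refine ⟨‖auxW o e1 e2 M t‖⁻¹ * (Real.sin (b - a))⁻¹ * Real.sin (b - t) * ‖auxW o e1 e2 M a‖,
      ‖auxW o e1 e2 M t‖⁻¹ * (Real.sin (b - a))⁻¹ * Real.sin (t - a) * ‖auxW o e1 e2 M b‖,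
      by positivity, by positivity, ?_⟩
    have : auxW o e1 e2 M t = (Real.sin (b - a))⁻¹ • (Real.sin (b - t) • auxW o e1 e2 M a +
        Real.sin (t - a) • auxW o e1 e2 M b) := by
      rw [← hWW, smul_smul, inv_mul_cancel₀ hsin.ne', one_smul]
    calc σ t = ‖auxW o e1 e2 M t‖⁻¹ • auxW o e1 e2 M t := rfl
      _ = ‖auxW o e1 e2 M t‖⁻¹ • ((Real.sin (b - a))⁻¹ • (Real.sin (b - t) • auxW o e1 e2 M a +
        Real.sin (t - a) • auxW o e1 e2 M b)) := by rw [← this]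
      _ = ‖auxW o e1 e2 M t‖⁻¹ • ((Real.sin (b - a))⁻¹ • (Real.sin (b - t) •
        (‖auxW o e1 e2 M a‖ • p) + Real.sin (t - a) • (‖auxW o e1 e2 M b‖ • q))) := by
          rw [← hWa, ← hWb]
      _ = _ := by module
  have hinjN : Set.InjOn γ (Set.Ico a (a + 2 * Real.pi)) := F.G_injOn N a
  have hinjM : Set.InjOn σ (Set.Ico a (a + 2 * Real.pi)) := F.G_injOn M a
  have hpq : p ≠ q := fun hh => hab.ne
    (hinjN ⟨le_rfl, by linarith⟩ ⟨hab.le, by linarith⟩ hh)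
  have hpx : p ≠ x := fun hh => hat.ne
    (hinjN ⟨le_rfl, by linarith⟩ ⟨hat.le, by linarith⟩ hh)
  have hqx : q ≠ x := fun hh => htb.ne'
    (hinjN ⟨hab.le, by linarith⟩ ⟨hat.le, by linarith⟩ hh)
  have hp1 : ‖p‖ = 1 := hγ1 a
  have hq1 : ‖q‖ = 1 := hγ1 b
  have hx1 : ‖x‖ = 1 := hγ1 t0
  have hNp : N p = 0 := h.N_G F a
  have hNq : N q = 0 := h.N_G F b
  have hind : ∀ y z : EuclideanSpace ℝ (Fin 3), ‖y‖ = 1 → ‖z‖ = 1 → N y = 0 → N z = 0 → y ≠ z →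
      z - (inner ℝ y z : ℝ) • y ≠ 0 := by
    intro y z hy hz hNy hNz hyz h0
    have hz' : z = (inner ℝ y z : ℝ) • y := sub_eq_zero.1 h0
    set c : ℝ := inner ℝ y z
    have hc : |c| = 1 := by
      rw [hz', norm_smul, hy, mul_one, Real.norm_eq_abs] at hz
      exact hz
    rcases (abs_eq zero_le_one).1 hc with h1 | h1
    · rw [h1, one_smul] at hz'; exact hyz hz'.symm
    · rw [h1, neg_one_smul] at hz'
      have := h.pt y hNy.le (by rw [← hz', hNz])
      rw [this, norm_zero] at hy
      linarith
  -- `x` lies strictly off the great circle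
  have hlx : 0 < l x := by
    have nt := F.norm_W N t0
    have : l x = ‖auxW o e1 e2 N t0‖⁻¹ * (l (auxV e1 e2 t0) - N (auxV e1 e2 t0)) := by
      rw [hx, hγ, auxG, map_smul, smul_eq_mul]
      congr 1
      rw [auxW, map_add, map_smul, hl, smul_eq_mul]; ring
    rw [this]
    exact mul_pos (inv_pos.2 (by linarith)) (by linarith)
  have hlσ : ∀ t ∈ Set.Icc a b, l (σ t) = 0 := by
    intro t ht
    rw [hσ, auxG, map_smul, auxW, map_add, map_smul, hl, hMl t ht]; simp
  have hsep : ∀ t ∈ Set.Icc a b, (inner ℝ p x : ℝ) < inner ℝ p (σ t) ∨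
      (inner ℝ q x : ℝ) < inner ℝ q (σ t) := by
    intro t ht
    by_contra hcon
    push Not at hcon
    obtain ⟨α, β, hα, hβ, hy⟩ := hcomb t ht
    have hy1 := hσ1 t
    have h1 : (1 : ℝ) ≤ inner ℝ (σ t) x := by
      have e1 : (inner ℝ (σ t) (σ t) : ℝ) = α * inner ℝ p (σ t) + β * inner ℝ q (σ t) := by
        nth_rewrite 1 [hy]
        rw [inner_add_left, real_inner_smul_left, real_inner_smul_left]
      have e2 : (inner ℝ (σ t) x : ℝ) = α * inner ℝ p x + β * inner ℝ q x := by
        rw [hy, inner_add_left, real_inner_smul_left, real_inner_smul_left]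
      rw [real_inner_self_eq_norm_sq, hy1] at e1
      rw [e2]
      have := mul_le_mul_of_nonneg_left hcon.1 hα
      have := mul_le_mul_of_nonneg_left hcon.2 hβ
      linarith
    have h2 : ‖σ t - x‖ ^ 2 ≤ 0 := by
      rw [norm_sub_sq_real, hy1, hx1]; linarith
    have h3 : σ t = x := by
      have : ‖σ t - x‖ = 0 := by nlinarith [norm_nonneg (σ t - x)]
      exact sub_eq_zero.1 (norm_eq_zero.1 this)
    have := hlσ t ht
    rw [h3] at this
    linarith
  set O1 := {t : ℝ | (inner ℝ p x : ℝ) < inner ℝ p (σ t)} with hO1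
  set O2 := {t : ℝ | (inner ℝ q x : ℝ) < inner ℝ q (σ t)} with hO2
  have hO1o : IsOpen O1 := isOpen_lt continuous_const (continuous_const.inner hcM)
  have hO2o : IsOpen O2 := isOpen_lt continuous_const (continuous_const.inner hcM)
  have hlt1 : ∀ y : EuclideanSpace ℝ (Fin 3), ‖y‖ = 1 → y ≠ x → (inner ℝ y x : ℝ) < inner ℝ y y := by
    intro y hy hyx
    rw [real_inner_self_eq_norm_sq, hy]
    by_contra hcon
    push Not at hcon
    have h2 : ‖y - x‖ ^ 2 ≤ 0 := by
      rw [norm_sub_sq_real, hy, hx1]; linarith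
    have : ‖y - x‖ = 0 := by nlinarith [norm_nonneg (y - x)]
    exact hyx (sub_eq_zero.1 (norm_eq_zero.1 this))
  have haO1 : a ∈ O1 := by
    change (inner ℝ p x : ℝ) < inner ℝ p (σ a)
    rw [hpa]; exact hlt1 p hp1 hpx
  have hbO2 : b ∈ O2 := by
    change (inner ℝ q x : ℝ) < inner ℝ q (σ b)
    rw [hqb]; exact hlt1 q hq1 hqx
  obtain ⟨t1, ht1, ht1O⟩ := isPreconnected_Icc (a := a) (b := b) O1 O2 hO1o hO2o
    (fun t ht => hsep t ht) ⟨a, ⟨le_rfl, hab.le⟩, haO1⟩ ⟨b, ⟨hab.le, le_rfl⟩, hbO2⟩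
  have hOo : IsOpen (O1 ∩ O2) := hO1o.inter hO2o
  obtain ⟨t2, ht2O, ht2⟩ : ((O1 ∩ O2) ∩ Set.Ioo a b).Nonempty := by
    have : t1 ∈ closure (Set.Ioo a b) := by rw [closure_Ioo hab.ne]; exact ht1
    exact mem_closure_iff.1 this _ hOo ht1O
  obtain ⟨t3, ht23, ht3⟩ : ∃ t3, t2 < t3 ∧ Set.Icc t2 t3 ⊆ (O1 ∩ O2) ∩ Set.Ioo a b := by
    obtain ⟨ε, hε, hball⟩ := Metric.isOpen_iff.1 (hOo.inter isOpen_Ioo) t2 ⟨ht2O, ht2⟩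
    refine ⟨t2 + ε / 2, by linarith, fun t ht => hball ?_⟩
    rw [Metric.mem_ball, Real.dist_eq, abs_of_nonneg (by linarith [ht.1])]
    linarith [ht.2]
  -- the two covering pieces
  set A1 := σ '' (Set.Icc a b ∩ {t | (inner ℝ p x : ℝ) ≤ inner ℝ p (σ t)}) with hA1
  set A2 := σ '' (Set.Icc a b ∩ {t | (inner ℝ q x : ℝ) ≤ inner ℝ q (σ t)}) with hA2
  have hA2m : MeasurableSet A2 := by
    refine IsClosed.measurableSet (IsCompact.isClosed (IsCompact.image ?_ hcM))
    exact isCompact_Icc.inter_right (isClosed_le continuous_const (continuous_const.inner hcM))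
  have hm1 : μH[1] A1 ≤ μH[1] (γ '' Set.Icc a t0) := by
    refine aux_arc_le _ _ p q x (isPreconnected_Icc.image _ hcN.continuousOn) ?_
      ⟨a, ⟨le_rfl, hat.le⟩, rfl⟩ ⟨t0, ⟨hat.le, le_rfl⟩, rfl⟩ (hind p q hp1 hq1 hNp hNq hpq) ?_
    · rintro _ ⟨t, -, rfl⟩; exact hγ1 t
    · rintro _ ⟨t, ⟨ht, ht'⟩, rfl⟩
      obtain ⟨α, β, hα, hβ, hy⟩ := hcomb t ht
      exact ⟨hσ1 t, ⟨α, β, hβ, hy⟩, ht'⟩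
  have hm2 : μH[1] A2 ≤ μH[1] (γ '' Set.Icc t0 b) := by
    refine aux_arc_le _ _ q p x (isPreconnected_Icc.image _ hcN.continuousOn) ?_
      ⟨b, ⟨htb.le, le_rfl⟩, rfl⟩ ⟨t0, ⟨le_rfl, htb.le⟩, rfl⟩ (hind q p hq1 hp1 hNq hNp hpq.symm) ?_
    · rintro _ ⟨t, -, rfl⟩; exact hγ1 t
    · rintro _ ⟨t, ⟨ht, ht'⟩, rfl⟩
      obtain ⟨α, β, hα, hβ, hy⟩ := hcomb t ht
      exact ⟨hσ1 t, ⟨β, α, hα, by rw [hy, add_comm]⟩, ht'⟩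
  have hcov : σ '' Set.Icc a b ⊆ A1 ∪ A2 := by
    rintro _ ⟨t, ht, rfl⟩
    rcases hsep t ht with h1 | h1
    · left; exact ⟨t, ⟨ht, h1.le⟩, rfl⟩
    · right; exact ⟨t, ⟨ht, h1.le⟩, rfl⟩
  have hinter : 0 < μH[1] (A1 ∩ A2) := by
    have hsub : σ '' Set.Icc t2 t3 ⊆ A1 ∩ A2 := by
      rintro _ ⟨t, ht, rfl⟩
      have ht' := ht3 ht
      have hI : t ∈ Set.Icc a b := ⟨ht'.2.1.le, ht'.2.2.le⟩
      have i1 : (inner ℝ p x : ℝ) < inner ℝ p (σ t) := ht'.1.1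
      have i2 : (inner ℝ q x : ℝ) < inner ℝ q (σ t) := ht'.1.2
      exact ⟨⟨t, ⟨hI, i1.le⟩, rfl⟩, ⟨t, ⟨hI, i2.le⟩, rfl⟩⟩
    refine lt_of_lt_of_le ?_ (MeasureTheory.measure_mono hsub)
    refine lt_of_lt_of_le ?_ (aux_chord_le σ hcM t2 t3 ht23.le)
    rw [edist_pos]
    intro heq
    have h3 := (ht3 ⟨ht23.le, le_rfl⟩).2
    exact ht23.ne (hinjM ⟨ht2.1.le, by linarith [ht2.2]⟩ ⟨h3.1.le, by linarith [h3.2]⟩ heq)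
  have hfin : μH[1] (σ '' Set.Icc a b) < ⊤ := hM.finite_arc F a b
  have hsplit : μH[1] (γ '' Set.Icc a t0) + μH[1] (γ '' Set.Icc t0 b) ≤
      μH[1] (γ '' Set.Icc a b) := by
    have hinj' : Set.InjOn γ (Set.Ico a b) :=
      hinjN.mono (Set.Ico_subset_Ico_right (by linarith))
    have h1 := aux_split γ hcN a t0 b hat.le htb.le hinj'
    have h2 : ∀ c d, μH[1] (γ '' Set.Icc c d) ≤ μH[1] (γ '' Set.Ico c d) := fun c d =>
      (aux_Icc_le_Ioo γ c d).trans
        (MeasureTheory.measure_mono (Set.image_mono Set.Ioo_subset_Ico_self))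
    calc _ ≤ μH[1] (γ '' Set.Ico a t0) + μH[1] (γ '' Set.Ico t0 b) := add_le_add (h2 _ _) (h2 _ _)
      _ = μH[1] (γ '' Set.Ico a b) := h1.symm
      _ ≤ _ := MeasureTheory.measure_mono (Set.image_mono Set.Ico_subset_Icc_self)
  calc μH[1] (σ '' Set.Icc a b)
      < μH[1] (σ '' Set.Icc a b) + μH[1] (A1 ∩ A2) := ENNReal.lt_add_right hfin.ne hinter.ne'
    _ ≤ μH[1] (A1 ∪ A2) + μH[1] (A1 ∩ A2) := by
        gcongr
    _ = μH[1] A1 + μH[1] A2 := MeasureTheory.measure_union_add_inter A1 hA2m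
    _ ≤ μH[1] (γ '' Set.Icc a t0) + μH[1] (γ '' Set.Icc t0 b) := add_le_add hm1 hm2
    _ ≤ _ := hsplit

theorem AuxSL.cut_strict (h : AuxSL o N) (F : AuxFrame o e1 e2)
    (l : EuclideanSpace ℝ (Fin 3) →ₗ[ℝ] ℝ) (hl : l o = -1) (t0 : ℝ)
    (ht0 : N (auxV e1 e2 t0) < l (auxV e1 e2 t0)) :
    μH[1] (auxD (fun x => max (N x) (l x))) < μH[1] (auxD N) := by
  have hpi := Real.pi_pos
  have hM := h.cutMax l hl
  obtain ⟨a, b, hat, htb, hba, hNa, hNb, hin, hout⟩ := h.cut_struct F l t0 ht0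
  set M := fun x => Max.max (N x) (l x) with hMdef
  have key := h.arc_strict hM F l hl a t0 b hat htb hba ht0 hNa hNb
    (fun t ht => max_eq_right (hin t ht))
  obtain ⟨K, hK⟩ := h.G_lip F
  obtain ⟨K', hK'⟩ := hM.G_lip F
  have hD1 := aux_split _ hK.continuous a b (a + 2 * Real.pi) (hat.trans htb).le (by linarith)
    (F.G_injOn N a)
  have hD2 := aux_split _ hK'.continuous a b (a + 2 * Real.pi) (hat.trans htb).le (by linarith)
    (F.G_injOn M a)
  rw [h.image_G F] at hD1
  rw [hM.image_G F] at hD2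
  have hEq : auxG o e1 e2 M '' Set.Ico b (a + 2 * Real.pi) =
      auxG o e1 e2 N '' Set.Ico b (a + 2 * Real.pi) := by
    refine Set.image_congr fun t ht => ?_
    have : M (auxV e1 e2 t) = N (auxV e1 e2 t) := max_eq_left (hout t ⟨ht.1, ht.2.le⟩)
    simp only [auxG, auxW, this]
  rw [hD1, hD2, hEq]
  have hfin : μH[1] (auxG o e1 e2 N '' Set.Ico b (a + 2 * Real.pi)) ≠ ⊤ :=
    ((MeasureTheory.measure_mono (Set.image_mono Set.Ico_subset_Icc_self)).trans_lt
      (h.finite_arc F b (a + 2 * Real.pi))).ne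
  refine ENNReal.add_lt_add_right hfin ?_
  calc _ ≤ μH[1] (auxG o e1 e2 M '' Set.Icc a b) :=
        MeasureTheory.measure_mono (Set.image_mono Set.Ico_subset_Icc_self)
    _ < _ := key
    _ ≤ μH[1] (auxG o e1 e2 N '' Set.Ioo a b) := aux_Icc_le_Ioo _ _ _
    _ ≤ _ := MeasureTheory.measure_mono (Set.image_mono Set.Ioo_subset_Ico_self)

theorem AuxSL.le_of_V (h : AuxSL o N) (hM : AuxSL o M) (F : AuxFrame o e1 e2)
    (hle : ∀ t, M (auxV e1 e2 t) ≤ N (auxV e1 e2 t)) (x : EuclideanSpace ℝ (Fin 3)) :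
    M x ≤ N x := by
  obtain ⟨r, t, hr, hx⟩ := F.polar x
  rw [hx, h.shift, hM.shift]
  rcases eq_or_lt_of_le hr with h0 | h0
  · rw [← h0, zero_smul, h.zero, hM.zero]
  · rw [h.hom r h0, hM.hom r h0]
    have := mul_le_mul_of_nonneg_left (hle t) hr
    linarith

theorem AuxSL.cut_le (h : AuxSL o N) (F : AuxFrame o e1 e2)
    (l : EuclideanSpace ℝ (Fin 3) →ₗ[ℝ] ℝ) (hl : l o = -1) :
    μH[1] (auxD (fun x => max (N x) (l x))) ≤ μH[1] (auxD N) := by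
  by_cases hc : ∃ t0, N (auxV e1 e2 t0) < l (auxV e1 e2 t0)
  · obtain ⟨t0, ht0⟩ := hc
    exact (h.cut_strict F l hl t0 ht0).le
  · push Not at hc
    have hM := h.cutMax l hl
    have h1 := h.le_of_V hM F (fun t => max_le le_rfl (hc t))
    have : (fun x => Max.max (N x) (l x)) = N := funext fun x => le_antisymm (h1 x) (le_max_left _ _)
    rw [this]

theorem AuxSL.mono {N1 N2 : EuclideanSpace ℝ (Fin 3) → ℝ} (h1 : AuxSL o N1) (h2 : AuxSL o N2)
    (F : AuxFrame o e1 e2) (hle : ∀ x, N2 x ≤ N1 x) :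
    μH[1] (auxD N1) ≤ μH[1] (auxD N2) := by
  have hpi := Real.pi_pos
  obtain ⟨K, hK⟩ := h1.G_lip F
  rw [← h1.image_G F 0, zero_add]
  refine (MeasureTheory.measure_mono (Set.image_mono Set.Ico_subset_Icc_self)).trans ?_
  refine (aux_image_le_variation _ 0 (2 * Real.pi) (by linarith)
    (hK.locallyBoundedVariationOn _)).trans ?_
  refine iSup_le ?_
  rintro ⟨n, ⟨u, hu, hmem⟩⟩
  simp only
  have hex : ∀ k : ℕ, ∃ M : EuclideanSpace ℝ (Fin 3) → ℝ, AuxSL o M ∧ (∀ x, M x ≤ N1 x) ∧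
      (∀ i < k, M (auxV e1 e2 (u i)) = N1 (auxV e1 e2 (u i))) ∧
      μH[1] (auxD M) ≤ μH[1] (auxD N2) := by
    intro k
    induction k with
    | zero => exact ⟨N2, h2, hle, by simp, le_rfl⟩
    | succ k ih =>
      obtain ⟨M, hM, hM1, hMk, hMm⟩ := ih
      have hv : auxV e1 e2 (u k) ≠ 0 := by
        intro h0
        have := F.norm_V (u k)
        rw [h0, norm_zero] at this
        linarith
      obtain ⟨l, hl, hlN, hlk⟩ := h1.support _ hv
      refine ⟨fun x => Max.max (M x) (l x), hM.cutMax l hl, fun x => max_le (hM1 x) (hlN x), ?_,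
        (hM.cut_le F l hl).trans hMm⟩
      intro i hi
      rcases Nat.lt_succ_iff_lt_or_eq.1 hi with hi | hi
      · simp only [hMk i hi]
        exact max_eq_left (hlN _)
      · subst hi
        simp only [hlk]
        exact max_eq_right (hM1 _)
  obtain ⟨M, hM, hM1, hMk, hMm⟩ := hex (n + 1)
  refine le_trans ?_ hMm
  obtain ⟨K', hK'⟩ := hM.G_lip F
  have hinj := F.G_injOn M 0
  rw [← hM.image_G F 0]
  rw [zero_add] at hinj ⊢
  refine le_trans (le_of_eq ?_) (aux_sum_le _ hK'.continuous 0 (2 * Real.pi) hinj u hu hmem n)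
  refine Finset.sum_congr rfl fun i hi => ?_
  have hi' := Finset.mem_range.1 hi
  have g1 : auxG o e1 e2 M (u i) = auxG o e1 e2 N1 (u i) := by
    simp only [auxG, auxW, hMk i (by omega)]
  have g2 : auxG o e1 e2 M (u (i + 1)) = auxG o e1 e2 N1 (u (i + 1)) := by
    simp only [auxG, auxW, hMk (i + 1) (by omega)]
  rw [g1, g2]

theorem AuxSL.strict {N1 N2 : EuclideanSpace ℝ (Fin 3) → ℝ} (h1 : AuxSL o N1) (h2 : AuxSL o N2)
    (F : AuxFrame o e1 e2) (hle : ∀ x, N2 x ≤ N1 x) (hne : N1 ≠ N2) :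
    μH[1] (auxD N1) < μH[1] (auxD N2) := by
  have hex : ∃ t, N2 (auxV e1 e2 t) < N1 (auxV e1 e2 t) := by
    by_contra hcon
    push Not at hcon
    exact hne (funext fun x => le_antisymm (h2.le_of_V h1 F hcon x) (hle x))
  obtain ⟨t, ht⟩ := hex
  have hv : auxV e1 e2 t ≠ 0 := by
    intro h0
    have := F.norm_V t
    rw [h0, norm_zero] at this
    linarith
  obtain ⟨l, hl, hlN, hlk⟩ := h1.support _ hv
  have hs := h2.cut_strict F l hl t (by rw [hlk]; exact ht)
  exact (h1.mono (h2.cutMax l hl) F (fun x => max_le (hle x) (hlN x))).trans_lt hs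

end



theorem aux_frame (o : EuclideanSpace ℝ (Fin 3)) (ho : ‖o‖ = 1) :
    ∃ e1 e2, AuxFrame o e1 e2 := by
  have hv : Orthonormal ℝ (Set.domRestrict ({2} : Set (Fin 3))
      (fun _ : Fin 3 => o)) := by
    constructor
    · intro i; exact ho
    · intro i j hij
      exact absurd (Subsingleton.elim i j) hij
  obtain ⟨b, hb⟩ := hv.exists_orthonormalBasis_extension_of_card_eq (by simp)
  have h2 : b 2 = o := hb 2 rfl
  refine ⟨b 0, b 1, ?_⟩
  have hin := fun i j => OrthonormalBasis.inner_eq_ite b i j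
  constructor
  · rw [← h2, hin]; simp
  · rw [hin]; simp
  · rw [hin]; simp
  · rw [← h2, hin]; simp
  · rw [← h2, hin]; simp
  · rw [hin]; simp
  · intro x
    have := b.sum_repr' x
    rw [Fin.sum_univ_three, h2] at this
    exact this.symm

theorem aux_normalize_near {x w : EuclideanSpace ℝ (Fin 3)} (hx : ‖x‖ = 1) (hw : w ≠ 0) :
    ‖‖w‖⁻¹ • w - x‖ ≤ 2 * ‖w - x‖ := by
  have hw0 : 0 < ‖w‖ := norm_pos_iff.2 hw
  have h1 : ‖‖w‖⁻¹ • w - w‖ ≤ ‖w - x‖ := by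
    have : ‖w‖⁻¹ • w - w = (‖w‖⁻¹ - 1) • w := by module
    rw [this, norm_smul, Real.norm_eq_abs]
    have h2 : |‖w‖⁻¹ - 1| * ‖w‖ = |‖x‖ - ‖w‖| := by
      rw [← abs_of_pos hw0, ← abs_mul, abs_of_pos hw0, sub_mul, inv_mul_cancel₀ hw0.ne', hx, one_mul]
    rw [h2, norm_sub_rev]
    exact abs_norm_sub_norm_le x w
  calc ‖‖w‖⁻¹ • w - x‖ = ‖(‖w‖⁻¹ • w - w) + (w - x)‖ := by congr 1; abel
    _ ≤ _ := norm_add_le _ _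
    _ ≤ _ := by linarith

theorem aux_cone_SL (C : Set (EuclideanSpace ℝ (Fin 3))) (o u : EuclideanSpace ℝ (Fin 3))
    (hadd : ∀ x ∈ C, ∀ y ∈ C, x + y ∈ C) (hsmul : ∀ x ∈ C, ∀ r : ℝ, 0 ≤ r → r • x ∈ C)
    (hcl : IsClosed C) (r : ℝ) (hr : 0 < r) (hball : ∀ y, ‖y‖ ≤ r → o + y ∈ C)
    (hu : ∀ x ∈ C, x ≠ 0 → 0 < (inner ℝ u x : ℝ)) (ho0 : o ≠ 0) :
    ∃ N, AuxSL o N ∧ ∀ x, x ∈ C ↔ N x ≤ 0 := by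
  have hoC : o ∈ C := by simpa using hball 0 (by simpa using hr.le)
  have h0C : (0 : EuclideanSpace ℝ (Fin 3)) ∈ C := by simpa using hsmul o hoC 0 le_rfl
  have huo : 0 < (inner ℝ u o : ℝ) := hu o hoC ho0
  have hu' : ∀ x ∈ C, 0 ≤ (inner ℝ u x : ℝ) := by
    intro x hx
    by_cases h : x = 0
    · simp [h]
    · exact (hu x hx h).le
  have hbig : ∀ x, x + (‖x‖ / r) • o ∈ C := by
    intro x
    by_cases h : x = 0
    · simpa [h] using h0C
    · have hx : 0 < ‖x‖ := norm_pos_iff.2 h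
      have h1 := hball ((r / ‖x‖) • x) (by
        rw [norm_smul, Real.norm_of_nonneg (by positivity), div_mul_cancel₀ _ hx.ne'])
      have h2 := hsmul _ h1 (‖x‖ / r) (by positivity)
      rw [smul_add, smul_smul, show ‖x‖ / r * (r / ‖x‖) = 1 by field_simp, one_smul, add_comm] at h2
      exact h2
  set S : EuclideanSpace ℝ (Fin 3) → Set ℝ := fun x => {s | x + s • o ∈ C} with hS
  have hSb : ∀ x, BddBelow (S x) := by
    intro x
    refine ⟨-(inner ℝ u x : ℝ) / inner ℝ u o, fun s hs => ?_⟩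
    have := hu' _ hs
    rw [inner_add_right, real_inner_smul_right] at this
    rw [div_le_iff₀ huo]; linarith
  have hSc : ∀ x, IsClosed (S x) := fun x =>
    hcl.preimage (continuous_const.add (continuous_id.smul continuous_const))
  set N : EuclideanSpace ℝ (Fin 3) → ℝ := fun x => sInf (S x) with hNdef
  have hmem : ∀ x, x + N x • o ∈ C := fun x => (hSc x).csInf_mem ⟨_, hbig x⟩ (hSb x)
  have hN : ∀ x s, x + s • o ∈ C ↔ N x ≤ s := by
    intro x s
    constructor
    · intro h; exact csInf_le (hSb x) h
    · intro h
      have := hadd _ (hmem x) _ (hsmul o hoC (s - N x) (by linarith))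
      rwa [add_assoc, ← add_smul, add_sub_cancel] at this
  have hhom : ∀ c : ℝ, 0 < c → ∀ x, N (c • x) ≤ c * N x := by
    intro c hc x
    rw [← hN]
    have := hsmul _ (hmem x) c hc.le
    rwa [smul_add, smul_smul] at this
  have hN0 : ∀ x, x ∈ C ↔ N x ≤ 0 := by
    intro x; rw [← hN, zero_smul, add_zero]
  refine ⟨N, ⟨?_, ?_, ?_, ?_, ?_⟩, hN0⟩
  · intro x y
    rw [← hN]
    have := hadd _ (hmem x) _ (hmem y)
    rwa [show x + N x • o + (y + N y • o) = x + y + (N x + N y) • o by module] at this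
  · intro c hc x
    refine le_antisymm (hhom c hc x) ?_
    have := hhom c⁻¹ (inv_pos.2 hc) (c • x)
    rw [smul_smul, inv_mul_cancel₀ hc.ne', one_smul] at this
    have h2 := mul_le_mul_of_nonneg_left this hc.le
    rwa [← mul_assoc, mul_inv_cancel₀ hc.ne', one_mul] at h2
  · intro x s
    refine eq_of_forall_ge_iff fun t => ?_
    rw [← hN, add_assoc, ← add_smul, hN, sub_le_iff_le_add, add_comm]
  · refine ⟨1 / r, by positivity, fun x => ?_⟩
    have := (hN x _).1 (hbig x)
    rwa [one_div_mul_eq_div]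
  · intro x h1 h2
    by_contra hx
    have a1 := hu x ((hN0 x).2 h1) hx
    have a2 := hu (-x) ((hN0 _).2 h2) (neg_ne_zero.2 hx)
    rw [inner_neg_right] at a2
    linarith



theorem SphericallyConvex.comb {K : Set S²} (hK : SphericallyConvex K) (x y z : S²) (hx : x ∈ K)
    (hy : y ∈ K) (α β : ℝ) (hα : 0 ≤ α) (hβ : 0 ≤ β)
    (hz : (z : EuclideanSpace ℝ (Fin 3)) = α • (x : EuclideanSpace ℝ (Fin 3)) +
      β • (y : EuclideanSpace ℝ (Fin 3))) : z ∈ K := by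
  have hn : ∀ w : S², ‖(w : EuclideanSpace ℝ (Fin 3))‖ = 1 := fun w => norm_eq_of_mem_sphere w
  have hang : ∀ w v : S², Real.arccos
      (inner ℝ (w : EuclideanSpace ℝ (Fin 3)) (v : EuclideanSpace ℝ (Fin 3))) =
      InnerProductGeometry.angle (w : EuclideanSpace ℝ (Fin 3)) (v : EuclideanSpace ℝ (Fin 3)) := by
    intro w v
    rw [InnerProductGeometry.angle, hn, hn]; simp
  refine hK x hx y hy z ?_
  rw [hang, hang, hang]
  symm
  have hz0 : (z : EuclideanSpace ℝ (Fin 3)) ≠ 0 := by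
    intro h; have := hn z; rw [h, norm_zero] at this; linarith
  rw [InnerProductGeometry.angle_eq_angle_add_angle_iff hz0]
  right
  rw [Submodule.mem_span_pair]
  exact ⟨⟨α, hα⟩, ⟨β, hβ⟩, hz.symm⟩

theorem aux_body (K : Set S²) (hK : SphericallyConvex K) (hKc : IsCompact K) (o : S²)
    (ho : o ∈ interior K) (u : EuclideanSpace ℝ (Fin 3))
    (hu : ∀ x ∈ K, 0 < (inner ℝ u (x : EuclideanSpace ℝ (Fin 3)) : ℝ)) :
    ∃ N, AuxSL (o : EuclideanSpace ℝ (Fin 3)) N ∧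
      (∀ x : S², x ∈ K ↔ N (x : EuclideanSpace ℝ (Fin 3)) ≤ 0) ∧
      μH[1] (frontier K) = μH[1] (auxD N) := by
  have hn : ∀ w : S², ‖(w : EuclideanSpace ℝ (Fin 3))‖ = 1 := fun w => norm_eq_of_mem_sphere w
  have hoK : o ∈ K := interior_subset ho
  have ho0 : (o : EuclideanSpace ℝ (Fin 3)) ≠ 0 := by
    intro h; have := hn o; rw [h, norm_zero] at this; linarith
  set C : Set (EuclideanSpace ℝ (Fin 3)) :=
    {x | ∃ k ∈ K, ∃ r : ℝ, 0 ≤ r ∧ x = r • (k : EuclideanSpace ℝ (Fin 3))} with hC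
  have hnorm : ∀ x : EuclideanSpace ℝ (Fin 3), x ≠ 0 → ‖x‖⁻¹ • x ∈
      Metric.sphere (0 : EuclideanSpace ℝ (Fin 3)) 1 := by
    intro x hx
    rw [mem_sphere_zero_iff_norm, norm_smul, norm_inv, norm_norm,
      inv_mul_cancel₀ (norm_ne_zero_iff.2 hx)]
  have hCiff : ∀ (x : EuclideanSpace ℝ (Fin 3)) (hx : x ≠ 0),
      x ∈ C ↔ (⟨‖x‖⁻¹ • x, hnorm x hx⟩ : S²) ∈ K := by
    intro x hx
    have hx0 : 0 < ‖x‖ := norm_pos_iff.2 hx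
    constructor
    · rintro ⟨k, hk, r, hr, hxk⟩
      have : ‖x‖ = r := by rw [hxk, norm_smul, hn, mul_one, Real.norm_of_nonneg hr]
      convert hk
      rw [this, hxk, smul_smul, inv_mul_cancel₀ (by rw [← this]; exact hx0.ne'), one_smul]
    · intro h
      refine ⟨_, h, ‖x‖, hx0.le, ?_⟩
      simp only
      rw [smul_smul, mul_inv_cancel₀ hx0.ne', one_smul]
  have hKC : ∀ x : S², x ∈ K ↔ (x : EuclideanSpace ℝ (Fin 3)) ∈ C := by
    intro x
    constructor
    · intro h; exact ⟨x, h, 1, zero_le_one, by simp⟩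
    · intro h
      have hx0 : (x : EuclideanSpace ℝ (Fin 3)) ≠ 0 := by
        intro h; have := hn x; rw [h, norm_zero] at this; linarith
      have h2 := (hCiff _ hx0).1 h
      convert h2
      rw [hn x]; simp
  have hpos : ∀ x ∈ C, x ≠ 0 → 0 < (inner ℝ u x : ℝ) := by
    rintro _ ⟨k, hk, r, hr, rfl⟩ hx
    have hr0 : r ≠ 0 := by rintro rfl; simp at hx
    rw [real_inner_smul_right]
    exact mul_pos (lt_of_le_of_ne hr hr0.symm) (hu k hk)
  have hsmul : ∀ x ∈ C, ∀ r : ℝ, 0 ≤ r → r • x ∈ C := by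
    rintro _ ⟨k, hk, s, hs, rfl⟩ r hr
    exact ⟨k, hk, r * s, by positivity, by rw [smul_smul]⟩
  have hadd : ∀ x ∈ C, ∀ y ∈ C, x + y ∈ C := by
    rintro _ ⟨k, hk, r, hr, rfl⟩ _ ⟨k', hk', r', hr', rfl⟩
    by_cases h0 : r • (k : EuclideanSpace ℝ (Fin 3)) + r' • (k' : EuclideanSpace ℝ (Fin 3)) = 0
    · rw [h0]; exact ⟨k, hk, 0, le_rfl, by simp⟩
    · rw [hCiff _ h0]
      refine hK.comb k k' _ hk hk'
        (‖r • (k : EuclideanSpace ℝ (Fin 3)) + r' • (k' : EuclideanSpace ℝ (Fin 3))‖⁻¹ * r)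
        (‖r • (k : EuclideanSpace ℝ (Fin 3)) + r' • (k' : EuclideanSpace ℝ (Fin 3))‖⁻¹ * r')
        (by positivity) (by positivity) ?_
      simp only [smul_add, smul_smul]
  have hcl : IsClosed C := by
    rw [← isOpen_compl_iff, Metric.isOpen_iff]
    intro x hx
    have hx0 : x ≠ 0 := by
      rintro rfl
      exact hx ⟨o, hoK, 0, le_rfl, by simp⟩
    have hxn : 0 < ‖x‖ := norm_pos_iff.2 hx0
    have hKcl : IsClosed ((fun y : S² => (y : EuclideanSpace ℝ (Fin 3))) '' K) :=
      (hKc.image continuous_subtype_val).isClosed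
    have hev : ∀ᶠ y in nhds x, y ≠ 0 ∧
        ‖y‖⁻¹ • y ∉ ((fun y : S² => (y : EuclideanSpace ℝ (Fin 3))) '' K) := by
      have hne : ∀ᶠ y in nhds x, y ≠ 0 := isOpen_ne.mem_nhds hx0
      refine hne.and ?_
      have hct : ContinuousAt (fun y : EuclideanSpace ℝ (Fin 3) => ‖y‖⁻¹ • y) x :=
        (continuousAt_id.norm.inv₀ hxn.ne').smul continuousAt_id
      refine hct.eventually (hKcl.isOpen_compl.mem_nhds ?_)
      rintro ⟨k, hk, hkx⟩
      apply hx
      rw [hCiff x hx0]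
      convert hk
      exact hkx.symm
    obtain ⟨ε, hε, hb⟩ := Metric.eventually_nhds_iff_ball.1 hev
    refine ⟨ε, hε, fun y hy hyC => ?_⟩
    obtain ⟨hy0, hy1⟩ := hb y hy
    exact hy1 ⟨_, (hCiff y hy0).1 hyC, rfl⟩
  have hnear : ∀ x ∈ interior K, ∃ r : ℝ, 0 < r ∧ ∀ y : EuclideanSpace ℝ (Fin 3), ‖y‖ ≤ r →
      (x : EuclideanSpace ℝ (Fin 3)) + y ∈ C := by
    intro x hx
    obtain ⟨ε, hε, hb⟩ := Metric.isOpen_iff.1 isOpen_interior x hx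
    refine ⟨min (ε / 4) (1 / 2), by positivity, fun y hy => ?_⟩
    have hy1 := hy.trans (min_le_left _ _)
    have hy2 := hy.trans (min_le_right _ _)
    have h0 : (x : EuclideanSpace ℝ (Fin 3)) + y ≠ 0 := by
      intro h
      have h1 : (x : EuclideanSpace ℝ (Fin 3)) = -y := eq_neg_of_add_eq_zero_left h
      have h2 := hn x
      rw [h1, norm_neg] at h2
      linarith
    rw [hCiff _ h0]
    apply interior_subset
    apply hb
    rw [Metric.mem_ball, Subtype.dist_eq, dist_eq_norm]
    refine (aux_normalize_near (hn x) h0).trans_lt ?_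
    rw [add_sub_cancel_left]
    linarith
  obtain ⟨r, hr, hball⟩ := hnear o ho
  obtain ⟨N, hN, hNC⟩ := aux_cone_SL C o u hadd hsmul hcl r hr hball hpos ho0
  refine ⟨N, hN, fun x => (hKC x).trans (hNC _), ?_⟩
  obtain ⟨L, hL⟩ := hN.lip
  have himg : (fun y : S² => (y : EuclideanSpace ℝ (Fin 3))) '' frontier K = auxD N := by
    rw [hKc.isClosed.frontier_eq]
    ext x
    constructor
    · rintro ⟨y, ⟨hyK, hyI⟩, rfl⟩
      refine ⟨hn y, le_antisymm ((hNC _).1 ((hKC y).1 hyK)) ?_⟩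
      by_contra hcon
      push Not at hcon
      apply hyI
      have hop : IsOpen {z : S² | N (z : EuclideanSpace ℝ (Fin 3)) < 0} :=
        isOpen_lt (hL.continuous.comp continuous_subtype_val) continuous_const
      have hsub : {z : S² | N (z : EuclideanSpace ℝ (Fin 3)) < 0} ⊆ K := by
        intro z hz
        have hz' : N (z : EuclideanSpace ℝ (Fin 3)) < 0 := hz
        exact (hKC z).2 ((hNC _).2 hz'.le)
      exact interior_maximal hsub hop hcon
    · rintro ⟨hx1, hx2⟩
      have hxs : x ∈ Metric.sphere (0 : EuclideanSpace ℝ (Fin 3)) 1 := by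
        rw [mem_sphere_zero_iff_norm]; exact hx1
      refine ⟨⟨x, hxs⟩, ⟨(hKC _).2 ((hNC _).2 hx2.le), fun hI => ?_⟩, rfl⟩
      obtain ⟨δ, hδ, hb⟩ := hnear _ hI
      have h1 := hb ((-δ) • (o : EuclideanSpace ℝ (Fin 3))) (by
        rw [norm_smul, hn, mul_one, norm_neg, Real.norm_of_nonneg hδ.le])
      rw [hNC, hN.shift] at h1
      simp only [hx2] at h1
      linarith
  rw [← himg]
  exact (isometry_subtype_coe.hausdorffMeasure_image (Or.inl zero_le_one) _).symm



/-- Monotonicity of spherical perimeter: if `K1 ⊆ K2` are spherical convex bodies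
contained in an open hemisphere, then the perimeter (one-dimensional Hausdorff
measure of the relative boundary) of `K1` is at most that of `K2`, with equality
only if `K1 = K2`. -/
theorem spherical_perimeter_mono
    (K1 K2 : Set S²)
    (hK1conv : SphericallyConvex K1) (hK2conv : SphericallyConvex K2)
    (hK1comp : IsCompact K1) (hK2comp : IsCompact K2)
    (hK1int : (interior K1).Nonempty) (hK2int : (interior K2).Nonempty)
    (hhemi : ∃ u : EuclideanSpace ℝ (Fin 3), ‖u‖ = 1 ∧
      ∀ x ∈ K2, 0 < ⟪u, (x : EuclideanSpace ℝ (Fin 3))⟫)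
    (hsub : K1 ⊆ K2) :
    μH[1] (frontier K1) ≤ μH[1] (frontier K2) ∧
      (μH[1] (frontier K1) = μH[1] (frontier K2) → K1 = K2) := by
  obtain ⟨u, -, hu⟩ := hhemi
  obtain ⟨o, ho⟩ := hK1int
  have ho2 : o ∈ interior K2 := interior_mono hsub ho
  obtain ⟨N1, h1, hK1, hm1⟩ := aux_body K1 hK1conv hK1comp o ho u (fun x hx => hu x (hsub hx))
  obtain ⟨N2, h2, hK2, hm2⟩ := aux_body K2 hK2conv hK2comp o ho2 u hu
  obtain ⟨e1, e2, F⟩ := aux_frame (o : EuclideanSpace ℝ (Fin 3)) (norm_eq_of_mem_sphere o)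
  have hle : ∀ x, N2 x ≤ N1 x := by
    refine h1.le_of_V h2 F fun t => ?_
    have hG := F.norm_G N1 t
    have hW := F.norm_W N1 t
    have hmem : auxG (o : EuclideanSpace ℝ (Fin 3)) e1 e2 N1 t ∈
        Metric.sphere (0 : EuclideanSpace ℝ (Fin 3)) 1 := by
      rw [mem_sphere_zero_iff_norm]; exact hG
    have hk1 : (⟨_, hmem⟩ : S²) ∈ K1 := (hK1 _).2 (h1.N_G F t).le
    have hk2 := (hK2 _).1 (hsub hk1)
    simp only [auxG] at hk2
    have hpos : 0 < ‖auxW (o : EuclideanSpace ℝ (Fin 3)) e1 e2 N1 t‖⁻¹ := inv_pos.2 (by linarith)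
    rw [h2.hom _ hpos] at hk2
    have hw : N2 (auxW (o : EuclideanSpace ℝ (Fin 3)) e1 e2 N1 t) ≤ 0 := by
      by_contra hcon
      push Not at hcon
      have := mul_pos hpos hcon
      linarith
    rw [auxW, h2.shift] at hw
    linarith
  rw [hm1, hm2]
  refine ⟨h1.mono h2 F hle, fun heq => ?_⟩
  by_cases hne : N1 = N2
  · ext x
    rw [hK1, hK2, hne]
  · exact absurd heq (h1.strict h2 F hle hne).ne

end
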